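/- arXiv:1111.3093 — 2 statements merged into one kernel-verified Lean document; each statement's English description precedes it below -/
import Mathlib

section
/- A map f : ℤ_2 → ℤ_2 is a 1-Lipschitz function that is bijective modulo 2^k for every k ≥ 1 (i.e., a measure-preserving T-function) if and only if there exist 2-adic integers c_0, c_1, c_2, … ∈ ℤ_2 such that f(x) = c_0 + x + Σ_{i=1}^∞ c_i·2^{⌊log_2 i⌋+1}·C(x,i) for all x ∈ ℤ_2. -/
/-- The map induced by `f : ℤ_[2] → ℤ_[2]` on `ℤ/2^kℤ` (for 1-Lipschitz `f` this is the
well-defined reduction of `f` modulo `2^k`). -/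
noncomputable def inducedMod (f : ℤ_[2] → ℤ_[2]) (k : ℕ) : ZMod (2 ^ k) → ZMod (2 ^ k) :=
  fun z => PadicInt.toZModPow k (f ((z.val : ℤ_[2])))

namespace PadicInt

variable {p : ℕ} [hp : Fact p.Prime]

lemma dvd_iff_norm_le {a b : ℤ_[p]} : a ∣ b ↔ ‖b‖ ≤ ‖a‖ := by
  constructor
  · rintro ⟨c, rfl⟩
    rw [norm_mul]
    exact mul_le_of_le_one_right (norm_nonneg _) (norm_le_one _)
  · intro h
    rcases eq_or_ne a 0 with rfl | ha
    · simp_all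
    · have ha' : (a : ℚ_[p]) ≠ 0 := coe_ne_zero.2 ha
      refine ⟨⟨b / a, ?_⟩, ?_⟩
      · rw [norm_div]
        exact div_le_one_of_le₀ h (norm_nonneg _)
      · apply PadicInt.ext
        exact (mul_div_cancel₀ (b : ℚ_[p]) ha').symm

lemma dvd_of_forall_pow_dvd {a b : ℤ_[p]} (h : ∀ k : ℕ, (p : ℤ_[p]) ^ k ∣ a → (p : ℤ_[p]) ^ k ∣ b) :
    a ∣ b := by
  rcases eq_or_ne a 0 with rfl | ha
  · by_contra hb
    have hb' : b ≠ 0 := fun h0 => hb (h0 ▸ dvd_rfl)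
    have := (mem_span_pow_iff_le_valuation b hb' (b.valuation + 1)).1
      (Ideal.mem_span_singleton.2 (h _ (dvd_zero _)))
    omega
  · have ha' := unitCoeff_spec ha
    have hd := h a.valuation ⟨_, ha'.trans (mul_comm _ _)⟩
    rw [ha']
    exact (unitCoeff ha).isUnit.mul_left_dvd.2 hd

lemma natCast_dvd_pow_log {j : ℕ} (hj : j ≠ 0) : (j : ℤ_[p]) ∣ (p : ℤ_[p]) ^ Nat.log p j := by
  obtain ⟨v, m, hm, rfl⟩ := Nat.exists_eq_pow_mul_and_not_dvd hj p hp.out.ne_one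
  have hu : IsUnit (m : ℤ_[p]) := by
    rw [isUnit_iff, norm_natCast_eq_one_iff]
    exact (hp.out.coprime_iff_not_dvd).2 hm
  push_cast
  refine hu.mul_right_dvd.2 (pow_dvd_pow _ ?_)
  refine Nat.le_log_of_pow_le hp.out.one_lt (Nat.le_of_dvd (Nat.pos_of_ne_zero hj) ⟨m, rfl⟩)

lemma dvd_pow_log_mul_choose (h : ℤ_[p]) {i j : ℕ} (hj : j ≠ 0) (hji : j ≤ i) :
    h ∣ (p : ℤ_[p]) ^ Nat.log p i * Ring.choose h j := by
  have h1 : h ∣ (j : ℤ_[p]) * Ring.choose h j := by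
    have := Ring.choose_smul_choose h (Nat.one_le_iff_ne_zero.2 hj)
    rw [Nat.choose_one_right, nsmul_eq_mul, Ring.choose_one_right] at this
    exact ⟨_, this⟩
  exact h1.trans (mul_dvd_mul_right
    ((natCast_dvd_pow_log hj).trans (pow_dvd_pow _ (Nat.log_mono_right hji))) _)

lemma sub_dvd_pow_log_mul_choose_sub (x y : ℤ_[p]) (i : ℕ) :
    x - y ∣ (p : ℤ_[p]) ^ Nat.log p i * (Ring.choose x i - Ring.choose y i) := by
  have hadd := Ring.add_choose_eq i (Commute.all (x - y) y)
  rw [sub_add_cancel, Finset.Nat.sum_antidiagonal_eq_sum_range_succ_mk,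
    Finset.sum_range_succ'] at hadd
  simp only [Nat.sub_zero, Ring.choose_zero_right, one_mul] at hadd
  rw [hadd, add_sub_cancel_right, Finset.mul_sum]
  refine Finset.dvd_sum fun j hj => ?_
  rw [← mul_assoc]
  exact (dvd_pow_log_mul_choose _ j.succ_ne_zero (Finset.mem_range.1 hj)).mul_right _

lemma pow_dvd_choose_pow_mul_pow_log (t : ℕ) {i j : ℕ} (hj : j ≠ 0) (hji : j ≤ i) :
    (p : ℤ_[p]) ^ t ∣ (p : ℤ_[p]) ^ Nat.log p i * ((p ^ t).choose j : ℕ) := by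
  have := dvd_pow_log_mul_choose ((p ^ t : ℕ) : ℤ_[p]) hj hji
  rwa [Ring.choose_natCast, Nat.cast_pow] at this

/-- Recurrence expressing the `(n + R)`-th difference at `0` through lower differences and
the increments of `f` along steps of length `R`. -/
lemma fwdDiff_iter_add_eq (f : ℤ_[p] → ℤ_[p]) (n : ℕ) {R : ℕ} (hR : R ≠ 0) :
    (fwdDiff 1)^[n + R] f 0 = ∑ k ∈ Finset.range (n + 1),
        ((-1 : ℤ) ^ (n - k) * n.choose k) • (f (k + R) - f k) -
      ∑ j ∈ Finset.range (R - 1), (R.choose (j + 1) : ℤ_[p]) * (fwdDiff 1)^[n + (j + 1)] f 0 := by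
  obtain ⟨r, rfl⟩ := Nat.exists_eq_succ_of_ne_zero hR
  have h1 := shift_eq_sum_fwdDiff_iter (1 : ℤ_[p]) ((fwdDiff 1)^[n] f) (r + 1) 0
  rw [Finset.sum_range_succ, Finset.sum_range_succ'] at h1
  simp only [← Function.iterate_add_apply, nsmul_eq_mul, mul_one, zero_add, Nat.choose_self,
    Nat.choose_zero_right, Nat.cast_one, one_mul] at h1
  have h2 : ∑ k ∈ Finset.range (n + 1),
      ((-1 : ℤ) ^ (n - k) * n.choose k) • (f (k + (r + 1 : ℕ)) - f k) =
      (fwdDiff 1)^[n] f (r + 1 : ℕ) - (fwdDiff 1)^[n] f 0 := by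
    simp only [fwdDiff_iter_eq_sum_shift (1 : ℤ_[p]) f n, smul_sub, Finset.sum_sub_distrib,
      nsmul_eq_mul, mul_one, add_comm, add_zero]
  rw [Nat.succ_eq_add_one, h2, h1, Nat.add_sub_cancel, add_comm n (r + 1)]
  simp only [add_comm n]
  ring

/-- Mahler coefficients of a function with `d * (x - y) ∣ f x - f y`. -/
lemma mul_pow_log_dvd_fwdDiff_iter {f : ℤ_[p] → ℤ_[p]} {d : ℤ_[p]}
    (hf : ∀ x y, d * (x - y) ∣ f x - f y) {i : ℕ} (hi : i ≠ 0) :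
    d * (p : ℤ_[p]) ^ Nat.log p i ∣ (fwdDiff 1)^[i] f 0 := by
  induction i using Nat.strong_induction_on with
  | _ i ih =>
    have hti : p ^ Nat.log p i ≤ i := Nat.pow_log_le_self p hi
    generalize Nat.log p i = t at hti ⊢
    have hpt : p ^ t ≠ 0 := pow_ne_zero _ hp.out.ne_zero
    obtain ⟨n, rfl⟩ := Nat.exists_eq_add_of_le' hti
    rw [fwdDiff_iter_add_eq f n hpt]
    refine dvd_sub (Finset.dvd_sum fun k _ => ?_) (Finset.dvd_sum fun j hj => ?_)
    · rw [zsmul_eq_mul]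
      refine Dvd.dvd.mul_left ?_ _
      simpa using hf (k + (p ^ t : ℕ)) k
    · have hj' := Finset.mem_range.1 hj
      have h1 := ih (n + (j + 1)) (by omega) (by omega)
      have h2 := pow_dvd_choose_pow_mul_pow_log (p := p) t (i := n + (j + 1)) j.succ_ne_zero
        (Nat.le_add_left _ _)
      calc d * (p : ℤ_[p]) ^ t
          ∣ d * ((p : ℤ_[p]) ^ Nat.log p (n + (j + 1)) * ((p ^ t).choose (j + 1) : ℕ)) :=
            mul_dvd_mul_left _ h2
        _ = ((p ^ t).choose (j + 1) : ℕ) * (d * (p : ℤ_[p]) ^ Nat.log p (n + (j + 1))) := by ring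
        _ ∣ _ := mul_dvd_mul_left _ h1

lemma toZModPow_eq_iff_dvd_sub {k : ℕ} {x y : ℤ_[p]} :
    toZModPow k x = toZModPow k y ↔ (p : ℤ_[p]) ^ k ∣ x - y := by
  rw [← sub_eq_zero, ← map_sub, ← RingHom.mem_ker, ker_toZModPow, Ideal.mem_span_singleton]

lemma pow_log_mul_tendsto_zero (c : ℕ → ℤ_[p]) :
    Filter.Tendsto (fun i => c i * (p : ℤ_[p]) ^ Nat.log p i) Filter.atTop (nhds 0) := by
  have hlog : Filter.Tendsto (Nat.log p) Filter.atTop Filter.atTop :=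
    Filter.tendsto_atTop_atTop.2 fun b => ⟨p ^ b, fun a ha =>
      Nat.le_log_of_pow_le hp.out.one_lt ha⟩
  have hp1 : ‖(p : ℤ_[p])‖ < 1 := by
    rw [norm_lt_one_iff_dvd]
  have h := ((tendsto_pow_atTop_nhds_zero_of_norm_lt_one hp1).comp hlog).norm
  rw [norm_zero] at h
  refine squeeze_zero_norm (fun i => ?_) h
  rw [norm_mul]
  exact mul_le_of_le_one_left (norm_nonneg _) (norm_le_one _)

end PadicInt

open PadicInt

lemma two_dvd_sub_one_of_isUnit {u : ℤ_[2]} (hu : IsUnit u) : 2 ∣ u - 1 := by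
  have h1 : ∀ z : ZMod (2 ^ 1), IsUnit z → z = 1 := by decide
  have := h1 _ (hu.map (toZModPow 1))
  rw [← map_one (toZModPow 1), toZModPow_eq_iff_dvd_sub] at this
  simpa using this

lemma inducedMod_toZModPow {f : ℤ_[2] → ℤ_[2]} (hf : ∀ a b, a - b ∣ f a - f b) (k : ℕ)
    (x : ℤ_[2]) : inducedMod f k (toZModPow k x) = toZModPow k (f x) := by
  refine toZModPow_eq_iff_dvd_sub.2 (dvd_trans ?_ (hf _ _))
  rw [← toZModPow_eq_iff_dvd_sub, map_natCast, ZMod.natCast_zmod_val]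

/-- Measure-preserving T-functions are exactly the functions of the form `x + 2 g(x)` with `g`
a T-function. -/
lemma lipschitz_and_bijective_inducedMod_iff (f : ℤ_[2] → ℤ_[2]) :
    ((∀ a b : ℤ_[2], ‖f a - f b‖ ≤ ‖a - b‖) ∧
        ∀ k : ℕ, 1 ≤ k → Function.Bijective (inducedMod f k)) ↔
      ∀ a b : ℤ_[2], 2 * (a - b) ∣ (f a - a) - (f b - b) := by
  simp only [← dvd_iff_norm_le]
  constructor
  · rintro ⟨hf, hbij⟩ a b
    have hdvd : f a - f b ∣ a - b := by
      refine dvd_of_forall_pow_dvd fun k hk => ?_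
      rcases Nat.eq_zero_or_pos k with rfl | hk0
      · simp
      rw [← toZModPow_eq_iff_dvd_sub] at hk ⊢
      apply (hbij k hk0).1
      rwa [inducedMod_toZModPow hf, inducedMod_toZModPow hf]
    obtain ⟨u, hu⟩ := associated_of_dvd_dvd (hf a b) hdvd
    have : f a - a - (f b - b) = (u - 1) * (a - b) := by linear_combination -hu
    rw [this]
    exact mul_dvd_mul_right (two_dvd_sub_one_of_isUnit u.isUnit) _
  · intro h
    have hiso : ∀ a b, ∃ u : ℤ_[2], IsUnit u ∧ f a - f b = u * (a - b) := by
      intro a b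
      obtain ⟨q, hq⟩ := h a b
      refine ⟨1 + 2 * q, ?_, by linear_combination hq⟩
      by_contra hu
      rw [not_isUnit_iff, norm_lt_one_iff_dvd] at hu
      exact prime_p.not_dvd_one ((dvd_add_left (Dvd.intro q rfl)).1 hu)
    have hf : ∀ a b, a - b ∣ f a - f b := fun a b => by
      obtain ⟨u, -, hu⟩ := hiso a b
      exact ⟨u, by rw [hu, mul_comm]⟩
    refine ⟨hf, fun k _ => Finite.injective_iff_bijective.1 fun y z hyz => ?_⟩
    obtain ⟨a, rfl⟩ := ZMod.ringHom_surjective (toZModPow k) y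
    obtain ⟨b, rfl⟩ := ZMod.ringHom_surjective (toZModPow k) z
    rw [inducedMod_toZModPow hf, inducedMod_toZModPow hf, toZModPow_eq_iff_dvd_sub] at hyz
    obtain ⟨u, hu, hab⟩ := hiso a b
    rw [hab, hu.dvd_mul_left] at hyz
    exact toZModPow_eq_iff_dvd_sub.2 hyz

/-- A map `f : ℤ_2 → ℤ_2` is a measure-preserving T-function (a 1-Lipschitz function that is
bijective modulo `2^k` for every `k ≥ 1`) if and only if
`f x = c_0 + x + Σ_{i≥1} c_i·2^{⌊log_2 i⌋+1}·C(x,i)` for suitable 2-adic integers `c_i`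
(here `C(x,i) = Ring.choose x i` is the `i`-th binomial coefficient polynomial). -/
theorem measure_preserving_iff_mahler_form
    (f : ℤ_[2] → ℤ_[2]) :
    ((∀ a b : ℤ_[2], ‖f a - f b‖ ≤ ‖a - b‖) ∧
        ∀ k : ℕ, 1 ≤ k → Function.Bijective (inducedMod f k)) ↔
      ∃ c : ℕ → ℤ_[2], ∀ x : ℤ_[2],
        f x = c 0 + x +
          ∑' i : ℕ, c (i + 1) * 2 ^ (Nat.log 2 (i + 1) + 1) * Ring.choose x (i + 1) := by
  rw [lipschitz_and_bijective_inducedMod_iff]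
  constructor
  · intro h
    have hd : ∀ i : ℕ, ∃ c : ℤ_[2],
        (fwdDiff 1)^[i + 1] (fun x => f x - x) 0 = c * 2 ^ (Nat.log 2 (i + 1) + 1) := fun i => by
      obtain ⟨c, hc⟩ := mul_pow_log_dvd_fwdDiff_iter h i.succ_ne_zero
      exact ⟨c, by rw [hc, Nat.cast_ofNat]; ring⟩
    choose c hc using hd
    have hcont : Continuous fun x => f x - x := by
      refine (LipschitzWith.of_dist_le_mul (K := 1) fun a b => ?_).continuous
      rw [NNReal.coe_one, one_mul, dist_eq_norm, dist_eq_norm, ← dvd_iff_norm_le]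
      exact (dvd_mul_left _ _).trans (h a b)
    refine ⟨fun i => Nat.casesOn i (f 0) c, fun x => ?_⟩
    have hs := ContinuousMap.hasSum_apply (hasSum_mahler ⟨_, hcont⟩) x
    have ht := hs.tsum_eq
    rw [hs.summable.tsum_eq_zero_add] at ht
    simp only [mahlerTerm_apply, mahler_apply, ContinuousMap.coe_mk, Function.iterate_zero, id,
      Ring.choose_zero_right, hc, smul_eq_mul, sub_zero, one_mul] at ht
    simp only [mul_comm (Ring.choose x _)] at ht
    linear_combination -ht
  · rintro ⟨c, hc⟩ a b
    have hsum : ∀ x : ℤ_[2], Summable fun i : ℕ =>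
        c (i + 1) * 2 ^ (Nat.log 2 (i + 1) + 1) * Ring.choose x (i + 1) := fun x => by
      refine NonarchimedeanAddGroup.summable_of_tendsto_cofinite_zero ?_
      rw [Nat.cofinite_eq_atTop]
      refine ((pow_log_mul_tendsto_zero fun i => c i * 2 * Ring.choose x i).comp
        (Filter.tendsto_add_atTop_nat 1)).congr fun i => ?_
      simp only [Function.comp_apply, Nat.cast_ofNat]
      ring
    rw [hc a, hc b]
    have : ∀ s t : ℤ_[2], c 0 + a + s - a - (c 0 + b + t - b) = s - t := fun s t => by ring
    rw [this, ← (hsum a).tsum_sub (hsum b), dvd_iff_norm_le]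
    refine (IsUltrametricDist.norm_tsum_le _).trans (ciSup_le fun i => ?_)
    rw [← dvd_iff_norm_le]
    have hi := sub_dvd_pow_log_mul_choose_sub a b (i + 1)
    rw [Nat.cast_ofNat] at hi
    convert! (mul_dvd_mul_left 2 hi).mul_left (c (i + 1)) using 1
    ring
end

section
/- A map f : ℤ_2 → ℤ_2 is a 1-Lipschitz function that is transitive modulo 2^k for every k ≥ 1 (i.e., an ergodic T-function) if and only if it can be represented as f(x) = b_0·χ(0,x) + b_1·χ(1,x) + Σ_{m=2}^∞ 2^{⌊log_2 m⌋}·b_m·χ(m,x) for suitable b_m ∈ ℤ_2 satisfying the following conditions simultaneously: (1) b_0 ≡ 1 (mod 2); (2) b_0 + b_1 ≡ 3 (mod 4); (3) |b_m|_2 = 1 for all m ≥ 2; (4) b_2 + b_3 ≡ 2 (mod 4); (5) Σ_{m=2^{n−1}}^{2^n−1} b_m ≡ 0 (mod 4) for every n ≥ 3. -/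
/-- `f` is transitive modulo `2^k`: the orbit of `0` under the induced map on `ℤ/2^kℤ` is
all of `ℤ/2^kℤ`. -/
def TransitiveMod (f : ℤ_[2] → ℤ_[2]) (k : ℕ) : Prop :=
  ∀ z : ZMod (2 ^ k), ∃ n : ℕ, (inducedMod f k)^[n] 0 = z

/-- The van der Put characteristic function `χ(m,·)`: the characteristic function (with values
in `{0,1} ⊆ ℤ_2`) of the ball `m + 2^{⌊log_2 m⌋+1}ℤ_2`, with the convention `⌊log_2 0⌋ = 0`. -/
noncomputable def vdpChi (m : ℕ) (x : ℤ_[2]) : ℤ_[2] :=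
  if ‖x - (m : ℤ_[2])‖ ≤ (2 : ℝ) ^ (-((Nat.log 2 m : ℤ) + 1)) then 1 else 0

namespace VanDerPut

open Finset Function

section FiniteOrbit

variable {α : Type*} {g : α → α} {a : α}

theorem exists_lt_iterate_eq {i j : ℕ} (hij : i < j) (h : g^[i] a = g^[j] a) (n : ℕ) :
    ∃ m < j, g^[m] a = g^[n] a := by
  induction n using Nat.strong_induction_on with
  | _ n ih =>
    by_cases hn : n < j
    · exact ⟨n, hn, rfl⟩
    · obtain ⟨m, hm, h'⟩ := ih (n - j + i) (by omega)
      refine ⟨m, hm, h'.trans ?_⟩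
      rw [iterate_add_apply, h, ← iterate_add_apply, Nat.sub_add_cancel (by omega)]

variable [Fintype α]

theorem card_le_of_iterate_eq (horb : ∀ z, ∃ n, g^[n] a = z) {i j : ℕ} (hij : i < j)
    (h : g^[i] a = g^[j] a) : Fintype.card α ≤ j := by
  have hs : Surjective (fun i : Fin j => g^[(i : ℕ)] a) := by
    intro z
    obtain ⟨n, rfl⟩ := horb z
    obtain ⟨m, hm, h'⟩ := exists_lt_iterate_eq hij h n
    exact ⟨⟨m, hm⟩, h'⟩
  simpa using Fintype.card_le_of_surjective _ hs

theorem bijective_iterate_of_orbit (horb : ∀ z, ∃ n, g^[n] a = z) :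
    Bijective (fun i : Fin (Fintype.card α) => g^[(i : ℕ)] a) := by
  rw [Fintype.bijective_iff_injective_and_card]
  refine ⟨fun i j hij => ?_, by simp⟩
  by_contra hne
  rcases lt_or_gt_of_ne (fun h => hne (Fin.ext h) : (i : ℕ) ≠ j) with h | h
  · exact absurd (card_le_of_iterate_eq horb h hij) (by omega)
  · exact absurd (card_le_of_iterate_eq horb h hij.symm) (by omega)

theorem sum_iterate_of_orbit {M : Type*} [AddCommMonoid M] (horb : ∀ z, ∃ n, g^[n] a = z)
    (H : α → M) : ∑ i ∈ range (Fintype.card α), H (g^[i] a) = ∑ z, H z := by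
  rw [← Fin.sum_univ_eq_sum_range (fun i => H (g^[i] a))]
  exact (bijective_iterate_of_orbit horb).sum_comp H

theorem iterate_card_of_orbit (horb : ∀ z, ∃ n, g^[n] a = z) (hg : Injective g) :
    g^[Fintype.card α] a = a := by
  obtain ⟨⟨j, hj⟩, h⟩ := (bijective_iterate_of_orbit horb).2 (g^[Fintype.card α] a)
  simp only at h
  have h1 : g^[Fintype.card α - j] a = g^[0] a := by
    apply hg.iterate j
    rw [← iterate_add_apply, show j + (Fintype.card α - j) = Fintype.card α by omega, ← h]
    rfl
  have := card_le_of_iterate_eq horb (by omega) h1.symm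
  obtain rfl : j = 0 := by omega
  exact h1

end FiniteOrbit

section Parity

theorem two_pow_dvd_sub_iff (k : ℕ) (a b : ℤ_[2]) :
    (2 : ℤ_[2]) ^ k ∣ a - b ↔ PadicInt.toZModPow k a = PadicInt.toZModPow k b := by
  rw [← sub_eq_zero, ← map_sub, ← RingHom.mem_ker, PadicInt.ker_toZModPow,
    Ideal.mem_span_singleton]
  norm_num

theorem two_pow_dvd_iff_norm_le (k : ℕ) (a : ℤ_[2]) :
    (2 : ℤ_[2]) ^ k ∣ a ↔ ‖a‖ ≤ (2 : ℝ) ^ (-(k : ℤ)) := by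
  have := PadicInt.norm_le_pow_iff_mem_span_pow a k
  rw [Ideal.mem_span_singleton] at this
  exact_mod_cast this.symm

theorem two_pow_dvd_natCast_sub_iff (k : ℕ) (a b : ℕ) :
    (2 : ℤ_[2]) ^ k ∣ (a : ℤ_[2]) - b ↔ (2 : ℤ) ^ k ∣ (a : ℤ) - b := by
  have := PadicInt.pow_p_dvd_int_iff (p := 2) k ((a : ℤ) - b)
  exact_mod_cast this

theorem eq_of_two_pow_dvd_natCast_sub {k a b : ℕ} (ha : a < 2 ^ k) (hb : b < 2 ^ k)
    (h : (2 : ℤ_[2]) ^ k ∣ (a : ℤ_[2]) - b) : a = b := by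
  rw [two_pow_dvd_natCast_sub_iff] at h
  have h1 : (b : ℤ) ≡ a [ZMOD ((2 ^ k : ℕ) : ℤ)] := Int.modEq_iff_dvd.2 (by exact_mod_cast h)
  rw [Int.natCast_modEq_iff] at h1
  exact (Nat.ModEq.eq_of_lt_of_lt h1 hb ha).symm

theorem exists_nat_two_pow_dvd_sub (k : ℕ) (x : ℤ_[2]) :
    ∃ r : ℕ, r < 2 ^ k ∧ (2 : ℤ_[2]) ^ k ∣ x - r :=
  ⟨x.appr k, x.appr_lt k, by simpa [Ideal.mem_span_singleton] using PadicInt.appr_spec k x⟩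

theorem eq_of_forall_two_pow_dvd_sub {x y : ℤ_[2]} (h : ∀ k, 1 ≤ k → (2 : ℤ_[2]) ^ k ∣ x - y) :
    x = y := by
  rw [← PadicInt.ext_of_toZModPow]
  intro n
  rw [← two_pow_dvd_sub_iff]
  exact (pow_dvd_pow 2 (Nat.le_succ n)).trans (h (n + 1) (by omega))

theorem two_dvd_or_two_dvd_sub_one (u : ℤ_[2]) : (2 : ℤ_[2]) ∣ u ∨ (2 : ℤ_[2]) ∣ u - 1 := by
  obtain ⟨r, hr, h⟩ := exists_nat_two_pow_dvd_sub 1 u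
  have : r = 0 ∨ r = 1 := by omega
  rcases this with rfl | rfl
  · left; simpa using h
  · right; simpa using h

theorem not_two_dvd_one : ¬ (2 : ℤ_[2]) ∣ 1 := by
  intro h
  have := eq_of_two_pow_dvd_natCast_sub (k := 1) (a := 1) (b := 0) (by simp) (by simp)
    (by simpa using h)
  omega

theorem two_dvd_sub_of_not_dvd {u v : ℤ_[2]} (hu : ¬ (2 : ℤ_[2]) ∣ u) (hv : ¬ (2 : ℤ_[2]) ∣ v) :
    (2 : ℤ_[2]) ∣ u - v := by
  have h1 := (two_dvd_or_two_dvd_sub_one u).resolve_left hu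
  have h2 := (two_dvd_or_two_dvd_sub_one v).resolve_left hv
  simpa using dvd_sub h1 h2

theorem norm_eq_one_iff_two_dvd_sub_one (u : ℤ_[2]) : ‖u‖ = 1 ↔ (2 : ℤ_[2]) ∣ u - 1 := by
  have h := PadicInt.norm_lt_one_iff_dvd u
  have h1 := PadicInt.norm_le_one u
  constructor
  · intro hu
    refine (two_dvd_or_two_dvd_sub_one u).resolve_left fun h2 => ?_
    exact absurd (h.2 (by exact_mod_cast h2)) (by rw [hu]; exact lt_irrefl _)
  · intro hu
    by_contra hne
    have h3 : (2 : ℤ_[2]) ∣ u := by exact_mod_cast h.1 (lt_of_le_of_ne h1 hne)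
    exact not_two_dvd_one (by simpa using dvd_sub h3 hu)

theorem lipschitz_iff_two_pow_dvd (f : ℤ_[2] → ℤ_[2]) :
    (∀ a b, ‖f a - f b‖ ≤ ‖a - b‖) ↔
      ∀ k a b, (2 : ℤ_[2]) ^ k ∣ a - b → (2 : ℤ_[2]) ^ k ∣ f a - f b := by
  constructor
  · intro h k a b hab
    rw [two_pow_dvd_iff_norm_le] at hab ⊢
    exact (h a b).trans hab
  · intro h a b
    by_cases hab : a - b = 0
    · rw [sub_eq_zero.1 hab]; simp
    · have hn := PadicInt.norm_eq_zpow_neg_valuation hab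
      have := h (a - b).valuation a b ((two_pow_dvd_iff_norm_le _ _).2 (by rw [hn]; simp))
      rw [two_pow_dvd_iff_norm_le] at this
      rw [hn]
      exact_mod_cast this

end Parity

section Dynamics

variable {f : ℤ_[2] → ℤ_[2]}

theorem semiconj_inducedMod
    (hf : ∀ k a b, (2 : ℤ_[2]) ^ k ∣ a - b → (2 : ℤ_[2]) ^ k ∣ f a - f b) (k : ℕ) :
    Semiconj (PadicInt.toZModPow (p := 2) k) f (inducedMod f k) := by
  intro x
  rw [inducedMod, ← two_pow_dvd_sub_iff]
  apply hf
  rw [two_pow_dvd_sub_iff]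
  simp

theorem inducedMod_iterate
    (hf : ∀ k a b, (2 : ℤ_[2]) ^ k ∣ a - b → (2 : ℤ_[2]) ^ k ∣ f a - f b) (k n : ℕ) (x : ℤ_[2]) :
    (inducedMod f k)^[n] (PadicInt.toZModPow k x) = PadicInt.toZModPow k (f^[n] x) :=
  (((semiconj_inducedMod hf k).iterate_right n) x).symm

theorem inducedMod_iterate_zero
    (hf : ∀ k a b, (2 : ℤ_[2]) ^ k ∣ a - b → (2 : ℤ_[2]) ^ k ∣ f a - f b) (k n : ℕ) :
    (inducedMod f k)^[n] 0 = PadicInt.toZModPow k (f^[n] 0) := by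
  rw [← inducedMod_iterate hf, map_zero]

theorem transitiveMod_iff
    (hf : ∀ k a b, (2 : ℤ_[2]) ^ k ∣ a - b → (2 : ℤ_[2]) ^ k ∣ f a - f b) (k : ℕ) :
    TransitiveMod f k ↔ ∀ x : ℤ_[2], ∃ n : ℕ, (2 : ℤ_[2]) ^ k ∣ f^[n] 0 - x := by
  simp only [TransitiveMod, two_pow_dvd_sub_iff, inducedMod_iterate_zero hf]
  exact ⟨fun h x => h _, fun h z => by simpa using h (z.val : ℤ_[2])⟩

theorem transitiveMod_zero
    (hf : ∀ k a b, (2 : ℤ_[2]) ^ k ∣ a - b → (2 : ℤ_[2]) ^ k ∣ f a - f b) : TransitiveMod f 0 := by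
  rw [transitiveMod_iff hf]
  exact fun x => ⟨0, by simp⟩

theorem not_two_pow_succ_dvd_two_pow (k : ℕ) : ¬ (2 : ℤ_[2]) ^ (k + 1) ∣ 2 ^ k := by
  intro h
  obtain ⟨c, hc⟩ := h
  refine not_two_dvd_one ⟨c, mul_left_cancel₀ (pow_ne_zero k two_ne_zero) ?_⟩
  rw [mul_one, ← mul_assoc, ← pow_succ, ← hc]

theorem inducedMod_injective
    (hf : ∀ k a b, (2 : ℤ_[2]) ^ k ∣ a - b → (2 : ℤ_[2]) ^ k ∣ f a - f b) {k : ℕ}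
    (hk : TransitiveMod f k) (hk1 : TransitiveMod f (k + 1)) : Injective (inducedMod f k) := by
  rw [Finite.injective_iff_surjective]
  have hzero : ∃ w, inducedMod f k w = 0 := by
    obtain ⟨n, hn⟩ := (transitiveMod_iff hf _).1 hk1 (2 ^ k)
    cases n with
    | zero => exact absurd hn (by simpa using not_two_pow_succ_dvd_two_pow k)
    | succ n =>
      refine ⟨PadicInt.toZModPow k (f^[n] 0), ?_⟩
      rw [← semiconj_inducedMod hf k, ← iterate_succ_apply' f, ← map_zero (PadicInt.toZModPow k),
        ← two_pow_dvd_sub_iff]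
      have h2 := (pow_dvd_pow (2 : ℤ_[2]) (Nat.le_succ k)).trans hn
      simpa using dvd_add h2 (dvd_refl (2 ^ k))
  intro z
  obtain ⟨n, rfl⟩ := hk z
  cases n with
  | zero => exact hzero
  | succ n => exact ⟨_, (iterate_succ_apply' _ _ _).symm⟩

theorem displacement_dvd_of_injective
    (hf : ∀ k a b, (2 : ℤ_[2]) ^ k ∣ a - b → (2 : ℤ_[2]) ^ k ∣ f a - f b)
    (hinj : ∀ k, Injective (inducedMod f k)) (k : ℕ) (a b : ℤ_[2]) (hab : (2 : ℤ_[2]) ^ k ∣ a - b) :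
    (2 : ℤ_[2]) ^ (k + 1) ∣ (f a - a) - (f b - b) := by
  by_cases h : (2 : ℤ_[2]) ^ (k + 1) ∣ a - b
  · have := dvd_sub (hf _ _ _ h) h
    rwa [show f a - a - (f b - b) = f a - f b - (a - b) by ring]
  · have h' : ¬ (2 : ℤ_[2]) ^ (k + 1) ∣ f a - f b := by
      intro h1
      apply h
      rw [two_pow_dvd_sub_iff] at h1 ⊢
      rw [semiconj_inducedMod hf, semiconj_inducedMod hf] at h1
      exact hinj _ h1
    obtain ⟨u, hu⟩ := hf _ _ _ hab
    obtain ⟨t, ht⟩ := hab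
    rw [show f a - a - (f b - b) = f a - f b - (a - b) by ring]
    rw [hu] at h' ⊢
    rw [ht] at h ⊢
    rw [← mul_sub, pow_succ]
    refine mul_dvd_mul_left _ (two_dvd_sub_of_not_dvd ?_ ?_)
    · exact fun h2 => h' (by rw [pow_succ]; exact mul_dvd_mul_left _ h2)
    · exact fun h2 => h (by rw [pow_succ]; exact mul_dvd_mul_left _ h2)

theorem iterate_two_pow_dvd_sub_sum
    (hf : ∀ k a b, (2 : ℤ_[2]) ^ k ∣ a - b → (2 : ℤ_[2]) ^ k ∣ f a - f b)
    (hd : ∀ k a b, (2 : ℤ_[2]) ^ k ∣ a - b → (2 : ℤ_[2]) ^ (k + 1) ∣ (f a - a) - (f b - b))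
    {k : ℕ} (hk : TransitiveMod f k) :
    (2 : ℤ_[2]) ^ (k + 1) ∣ f^[2 ^ k] 0 - ∑ x ∈ range (2 ^ k), (f x - x) := by
  set H : ZMod (2 ^ k) → ZMod (2 ^ (k + 1)) := fun z =>
    PadicInt.toZModPow (k + 1) (f (z.val : ℤ_[2]) - (z.val : ℤ_[2])) with hHdef
  have hH : ∀ x : ℤ_[2], H (PadicInt.toZModPow k x) = PadicInt.toZModPow (k + 1) (f x - x) := by
    intro x
    rw [hHdef, ← two_pow_dvd_sub_iff]
    apply hd
    rw [two_pow_dvd_sub_iff]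
    simp
  have h1 := sum_iterate_of_orbit hk H
  have h2 := (Fin.sum_univ_eq_sum_range (fun i : ℕ => H i) (2 ^ k))
  have h3 : ∑ z, H z = ∑ i ∈ range (2 ^ k), H i := by
    rw [← h2]
    have hb : Bijective (fun i : Fin (2 ^ k) => ((i : ℕ) : ZMod (2 ^ k))) := by
      rw [Fintype.bijective_iff_surjective_and_card]
      exact ⟨fun z => ⟨⟨z.val, z.val_lt⟩, by simp⟩, by simp⟩
    exact (hb.sum_comp H).symm
  rw [two_pow_dvd_sub_iff, map_sum]
  rw [ZMod.card] at h1
  have h4 : f^[2 ^ k] 0 = ∑ i ∈ range (2 ^ k), (f (f^[i] 0) - f^[i] 0) := by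
    have := Finset.sum_range_sub (fun i => f^[i] 0) (2 ^ k)
    simp only [iterate_succ_apply', iterate_zero, id, sub_zero] at this
    exact this.symm
  rw [h4, map_sum]
  calc _ = ∑ i ∈ range (2 ^ k), H ((inducedMod f k)^[i] 0) := by
        simp only [inducedMod_iterate_zero hf, hH]
    _ = ∑ i ∈ range (2 ^ k), H i := h1.trans h3
    _ = _ := by
        refine sum_congr rfl fun i _ => ?_
        rw [← hH, map_natCast]

theorem iterate_displacement_dvd
    (hf : ∀ k a b, (2 : ℤ_[2]) ^ k ∣ a - b → (2 : ℤ_[2]) ^ k ∣ f a - f b)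
    (hd : ∀ k a b, (2 : ℤ_[2]) ^ k ∣ a - b → (2 : ℤ_[2]) ^ (k + 1) ∣ (f a - a) - (f b - b))
    (k n : ℕ) (a b : ℤ_[2]) (hab : (2 : ℤ_[2]) ^ k ∣ a - b) :
    (2 : ℤ_[2]) ^ k ∣ f^[n] a - f^[n] b ∧
      (2 : ℤ_[2]) ^ (k + 1) ∣ (f^[n] a - f^[n] b) - (a - b) := by
  induction n with
  | zero => simpa using hab
  | succ n ih =>
    simp only [iterate_succ_apply']
    refine ⟨hf _ _ _ ih.1, ?_⟩
    have := dvd_add (hd _ _ _ ih.1) ih.2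
    convert this using 1
    ring

theorem transitiveMod_succ_iff
    (hf : ∀ k a b, (2 : ℤ_[2]) ^ k ∣ a - b → (2 : ℤ_[2]) ^ k ∣ f a - f b)
    (hd : ∀ k a b, (2 : ℤ_[2]) ^ k ∣ a - b → (2 : ℤ_[2]) ^ (k + 1) ∣ (f a - a) - (f b - b))
    {k : ℕ} (hk : TransitiveMod f k) :
    TransitiveMod f (k + 1) ↔
      (2 : ℤ_[2]) ^ (k + 1) ∣ ∑ x ∈ range (2 ^ k), (f x - x) - 2 ^ k := by
  have hS := iterate_two_pow_dvd_sub_sum hf hd hk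
  constructor
  · intro hk1
    have h0 := iterate_card_of_orbit hk (inducedMod_injective hf hk hk1)
    rw [ZMod.card, inducedMod_iterate_zero hf, ← map_zero (PadicInt.toZModPow k),
      ← two_pow_dvd_sub_iff, sub_zero] at h0
    have h1 : ¬ (2 : ℤ_[2]) ^ (k + 1) ∣ f^[2 ^ k] 0 := by
      intro h
      have h2 : (inducedMod f (k + 1))^[0] 0 = (inducedMod f (k + 1))^[2 ^ k] 0 := by
        rw [inducedMod_iterate_zero hf, inducedMod_iterate_zero hf, eq_comm, ← two_pow_dvd_sub_iff]
        simpa using h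
      have := card_le_of_iterate_eq hk1 (by positivity) h2
      rw [ZMod.card, pow_succ] at this
      have : 0 < 2 ^ k := by positivity
      omega
    obtain ⟨u, hu⟩ := h0
    have h2 : (2 : ℤ_[2]) ^ (k + 1) ∣ f^[2 ^ k] 0 - 2 ^ k := by
      rw [hu, pow_succ] at h1 ⊢
      rw [show (2 : ℤ_[2]) ^ k * u - 2 ^ k = 2 ^ k * (u - 1) by ring]
      exact mul_dvd_mul_left _
        (two_dvd_sub_of_not_dvd (fun h => h1 (mul_dvd_mul_left _ h)) not_two_dvd_one)
    have := dvd_sub h2 hS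
    convert this using 1
    ring
  · intro h
    have hy : (2 : ℤ_[2]) ^ (k + 1) ∣ f^[2 ^ k] 0 - 2 ^ k := by
      have := dvd_add hS h
      convert this using 1
      ring
    rw [transitiveMod_iff hf] at hk ⊢
    intro x
    obtain ⟨n, u, hu⟩ := hk x
    by_cases h2 : (2 : ℤ_[2]) ∣ u
    · exact ⟨n, by rw [hu, pow_succ]; exact mul_dvd_mul_left _ h2⟩
    · refine ⟨n + 2 ^ k, ?_⟩
      rw [iterate_add_apply]
      have hy' : (2 : ℤ_[2]) ^ k ∣ f^[2 ^ k] 0 - 0 := by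
        have := dvd_add ((pow_dvd_pow (2 : ℤ_[2]) (Nat.le_succ k)).trans hy) (dvd_refl (2 ^ k))
        simpa using this
      have h3 := dvd_add (iterate_displacement_dvd hf hd k n _ _ hy').2 hy
      have h4 : (2 : ℤ_[2]) ^ (k + 1) ∣ 2 ^ k * u + 2 ^ k := by
        rw [pow_succ, show (2 : ℤ_[2]) ^ k * u + 2 ^ k = 2 ^ k * ((u - 1) + 2) by ring]
        exact mul_dvd_mul_left _
          (dvd_add (two_dvd_sub_of_not_dvd h2 not_two_dvd_one) (dvd_refl 2))
      rw [← hu] at h4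
      have := dvd_add h3 h4
      convert this using 1
      ring

end Dynamics

section Coefficients

/-- The sequence `b` is the sequence of normalized van der Put coefficients of `f`. -/
structure IsCoeff (f : ℤ_[2] → ℤ_[2]) (b : ℕ → ℤ_[2]) : Prop where
  zero : f 0 = b 0
  one : f 1 = b 1
  add_eq : ∀ n, 1 ≤ n → ∀ r < 2 ^ n,
    f ((2 ^ n + r : ℕ) : ℤ_[2]) = f (r : ℤ_[2]) + 2 ^ n * b (2 ^ n + r)

/-- The partial sum of the van der Put series over all indices below `max 2 (2 ^ N)`. -/
noncomputable def partialSum (b : ℕ → ℤ_[2]) (N : ℕ) (x : ℤ_[2]) : ℤ_[2] :=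
  b 0 * vdpChi 0 x + b 1 * vdpChi 1 x +
    ∑ m ∈ Ico 2 (2 ^ N), 2 ^ (Nat.log 2 m) * b m * vdpChi m x

variable {f : ℤ_[2] → ℤ_[2]} {b : ℕ → ℤ_[2]}

open Classical in
theorem vdpChi_eq (m : ℕ) (x : ℤ_[2]) :
    vdpChi m x = if (2 : ℤ_[2]) ^ (Nat.log 2 m + 1) ∣ x - m then 1 else 0 := by
  rw [vdpChi]
  refine if_congr ?_ rfl rfl
  rw [two_pow_dvd_iff_norm_le]
  push_cast
  rfl

theorem vdpChi_congr {N m : ℕ} (hm : m < 2 ^ N) (hN : 1 ≤ N) {x y : ℤ_[2]}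
    (h : (2 : ℤ_[2]) ^ N ∣ x - y) : vdpChi m x = vdpChi m y := by
  classical
  have hlog : Nat.log 2 m + 1 ≤ N := Nat.log_lt_of_lt_pow' (by omega) hm
  have h' := (pow_dvd_pow (2 : ℤ_[2]) hlog).trans h
  rw [vdpChi_eq, vdpChi_eq]
  refine if_congr ⟨fun h1 => ?_, fun h1 => ?_⟩ rfl rfl
  · simpa using dvd_sub h1 h'
  · simpa using dvd_add h1 h'

theorem partialSum_congr {N : ℕ} (hN : 1 ≤ N) {x y : ℤ_[2]}
    (h : (2 : ℤ_[2]) ^ N ∣ x - y) : partialSum b N x = partialSum b N y := by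
  have h2 : 2 ≤ 2 ^ N := by simpa using Nat.pow_le_pow_right (n := 2) (by norm_num) hN
  rw [partialSum, partialSum, vdpChi_congr (by omega) hN h, vdpChi_congr (by omega) hN h]
  congr 1
  refine sum_congr rfl fun m hm => ?_
  rw [vdpChi_congr (mem_Ico.1 hm).2 hN h]

theorem vdpChi_natCast {n m r : ℕ} (hm : 2 ^ n ≤ m) (hm' : m < 2 ^ (n + 1)) (hr : r < 2 ^ (n + 1)) :
    vdpChi m r = if m = r then 1 else 0 := by
  classical
  have hlog : Nat.log 2 m = n := Nat.log_eq_of_pow_le_of_lt_pow hm hm'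
  rw [vdpChi_eq, hlog]
  refine if_congr ⟨fun h => ?_, fun h => by simp [h]⟩ rfl rfl
  exact (eq_of_two_pow_dvd_natCast_sub hr hm' h).symm

theorem partialSum_succ {n r : ℕ} (hn : 1 ≤ n) (hr : r < 2 ^ (n + 1)) :
    partialSum b (n + 1) r = partialSum b n r + if 2 ^ n ≤ r then 2 ^ n * b r else 0 := by
  have h2 : 2 ≤ 2 ^ n := by simpa using Nat.pow_le_pow_right (n := 2) (by norm_num) hn
  have h3 : 2 ^ n ≤ 2 ^ (n + 1) := Nat.pow_le_pow_right (by norm_num) (by omega)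
  rw [partialSum, partialSum, ← sum_Ico_consecutive _ h2 h3, ← add_assoc]
  congr 1
  have : ∀ m ∈ Ico (2 ^ n) (2 ^ (n + 1)), 2 ^ (Nat.log 2 m) * b m * vdpChi m r =
      if m = r then 2 ^ n * b r else 0 := by
    intro m hm
    obtain ⟨h4, h5⟩ := mem_Ico.1 hm
    rw [vdpChi_natCast h4 h5 hr, Nat.log_eq_of_pow_le_of_lt_pow h4 h5]
    split_ifs with h
    · rw [h, mul_one]
    · rw [mul_zero]
  rw [sum_congr rfl this, sum_ite_eq']
  simp [hr]

theorem partialSum_one (b : ℕ → ℤ_[2]) :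
    partialSum b 1 (0 : ℕ) = b 0 ∧ partialSum b 1 (1 : ℕ) = b 1 := by
  classical
  constructor
  · simp [partialSum, vdpChi_eq, not_two_dvd_one]
  · simp [partialSum, vdpChi_eq, not_two_dvd_one]

theorem IsCoeff.partialSum_eq (hb : IsCoeff f b) {N : ℕ} (hN : 1 ≤ N) :
    ∀ r : ℕ, r < 2 ^ N → partialSum b N r = f r := by
  induction N, hN using Nat.le_induction with
  | base =>
    intro r hr
    have h : r = 0 ∨ r = 1 := by omega
    rcases h with rfl | rfl
    · rw [(partialSum_one b).1, Nat.cast_zero, hb.zero]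
    · rw [(partialSum_one b).2, Nat.cast_one, hb.one]
  | succ n hn ih =>
    intro r hr
    rw [partialSum_succ hn hr]
    split_ifs with h
    · obtain ⟨s, rfl⟩ := Nat.exists_eq_add_of_le h
      have hs : s < 2 ^ n := by rw [pow_succ] at hr; omega
      rw [hb.add_eq n hn s hs, ← ih s hs, partialSum_congr hn (y := s)]
      simp
    · rw [add_zero, ih r (by omega)]

theorem isCoeff_of_partialSum_eq (h : ∀ N, 1 ≤ N → ∀ r : ℕ, r < 2 ^ N → partialSum b N r = f r) :
    IsCoeff f b where
  zero := by simpa using (h 1 le_rfl 0 (by norm_num)).symm.trans (partialSum_one b).1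
  one := by simpa using (h 1 le_rfl 1 (by norm_num)).symm.trans (partialSum_one b).2
  add_eq n hn r hr := by
    rw [← h (n + 1) (by omega) (2 ^ n + r) (by rw [pow_succ]; omega),
      partialSum_succ hn (by rw [pow_succ]; omega), if_pos (by omega), ← h n hn r hr,
      partialSum_congr hn (y := r)]
    simp

theorem summable_vdp (b : ℕ → ℤ_[2]) (x : ℤ_[2]) :
    Summable fun m : ℕ => 2 ^ (Nat.log 2 (m + 2)) * b (m + 2) * vdpChi (m + 2) x := by
  have hlog : Filter.Tendsto (fun m : ℕ => Nat.log 2 (m + 2)) Filter.atTop Filter.atTop :=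
    Filter.tendsto_atTop.2 fun n => by
      filter_upwards [Filter.eventually_ge_atTop (2 ^ n)] with m hm
      exact Nat.le_log_of_pow_le (by norm_num) (by omega)
  apply NonarchimedeanAddGroup.summable_of_tendsto_cofinite_zero
  rw [Nat.cofinite_eq_atTop]
  have h2 : Filter.Tendsto (fun n : ℕ => (1 / 2 : ℝ) ^ n) Filter.atTop (nhds 0) :=
    tendsto_pow_atTop_nhds_zero_of_lt_one (by norm_num) (by norm_num)
  refine squeeze_zero_norm (fun m => ?_) (h2.comp hlog)
  have h3 := (two_pow_dvd_iff_norm_le (Nat.log 2 (m + 2)) _).1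
    ((Dvd.intro _ rfl).mul_right (vdpChi (m + 2) x) :
      _ ∣ 2 ^ (Nat.log 2 (m + 2)) * b (m + 2) * vdpChi (m + 2) x)
  simpa using h3

theorem sum_Ico_two_eq {M : Type*} [AddCommMonoid M] (t : ℕ → M) (N : ℕ) :
    ∑ m ∈ Ico 2 N, t m = ∑ m ∈ range (N - 2), t (m + 2) := by
  rw [sum_Ico_eq_sum_range]
  simp only [add_comm]

/-- The sum of the van der Put series. -/
noncomputable def series (b : ℕ → ℤ_[2]) (x : ℤ_[2]) : ℤ_[2] :=
  b 0 * vdpChi 0 x + b 1 * vdpChi 1 x +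
    ∑' m : ℕ, 2 ^ (Nat.log 2 (m + 2)) * b (m + 2) * vdpChi (m + 2) x

theorem two_pow_dvd_series_sub_partialSum (b : ℕ → ℤ_[2]) {N : ℕ} (hN : 1 ≤ N) (x : ℤ_[2]) :
    (2 : ℤ_[2]) ^ N ∣ series b x - partialSum b N x := by
  have h2 : 2 ≤ 2 ^ N := by simpa using Nat.pow_le_pow_right (n := 2) (by norm_num) hN
  rw [series, partialSum, sum_Ico_two_eq, ← (summable_vdp b x).sum_add_tsum_nat_add (2 ^ N - 2),
    add_sub_add_left_eq_sub, add_sub_cancel_left, two_pow_dvd_iff_norm_le]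
  refine IsUltrametricDist.norm_tsum_le_of_forall_le fun m => ?_
  rw [← two_pow_dvd_iff_norm_le]
  refine Dvd.dvd.mul_right (Dvd.dvd.mul_right (pow_dvd_pow _ ?_) _) _
  exact Nat.le_log_of_pow_le (by norm_num) (by omega)

theorem series_natCast (b : ℕ → ℤ_[2]) {N : ℕ} (hN : 1 ≤ N) {r : ℕ} (hr : r < 2 ^ N) :
    series b r = partialSum b N r := by
  apply eq_of_forall_two_pow_dvd_sub
  intro k hk
  have hstep : ∀ M, N ≤ M → partialSum b M r = partialSum b N r := by
    intro M hM
    induction M, hM using Nat.le_induction with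
    | base => rfl
    | succ n hn ih =>
      have : r < 2 ^ n := hr.trans_le (Nat.pow_le_pow_right (by norm_num) hn)
      rw [partialSum_succ (by omega) (by rw [pow_succ]; omega), if_neg (by omega), add_zero, ih]
  rw [← hstep (max N k) (le_max_left _ _)]
  exact (pow_dvd_pow _ (le_max_right _ _)).trans
    (two_pow_dvd_series_sub_partialSum b (by omega) _)

theorem lipschitz_and_isCoeff_iff :
    ((∀ k a c, (2 : ℤ_[2]) ^ k ∣ a - c → (2 : ℤ_[2]) ^ k ∣ f a - f c) ∧ IsCoeff f b) ↔
      ∀ x, f x = series b x := by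
  constructor
  · rintro ⟨hf, hb⟩ x
    apply eq_of_forall_two_pow_dvd_sub
    intro k hk
    obtain ⟨r, hr, hxr⟩ := exists_nat_two_pow_dvd_sub k x
    have h1 := two_pow_dvd_series_sub_partialSum b hk x
    rw [partialSum_congr hk hxr, hb.partialSum_eq hk r hr] at h1
    simpa using dvd_sub (hf k _ _ hxr) h1
  · intro h
    refine ⟨fun k a c hac => ?_, isCoeff_of_partialSum_eq fun N hN r hr => ?_⟩
    · rcases Nat.eq_zero_or_pos k with rfl | hk
      · simp
      have h1 := two_pow_dvd_series_sub_partialSum b hk a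
      rw [partialSum_congr hk hac] at h1
      rw [h, h]
      simpa using dvd_sub h1 (two_pow_dvd_series_sub_partialSum b hk c)
    · rw [h, series_natCast b hN hr]

theorem exists_isCoeff
    (hf : ∀ k a c, (2 : ℤ_[2]) ^ k ∣ a - c → (2 : ℤ_[2]) ^ k ∣ f a - f c) : ∃ b, IsCoeff f b := by
  have h : ∀ m : ℕ, ∃ c : ℤ_[2], (m = 0 → c = f 0) ∧ (m = 1 → c = f 1) ∧
      ∀ n, 1 ≤ n → ∀ r < 2 ^ n, m = 2 ^ n + r → f (m : ℤ_[2]) = f (r : ℤ_[2]) + 2 ^ n * c := by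
    intro m
    rcases lt_or_ge m 2 with hm | hm
    · refine ⟨f m, by rintro rfl; simp, by rintro rfl; simp, fun n hn r hr h => ?_⟩
      have : 2 ≤ 2 ^ n := by simpa using Nat.pow_le_pow_right (n := 2) (by norm_num) hn
      omega
    · have hle := Nat.pow_log_le_self 2 (show m ≠ 0 by omega)
      obtain ⟨c, hc⟩ := hf (Nat.log 2 m) m ((m - 2 ^ Nat.log 2 m : ℕ) : ℤ_[2])
        (by push_cast [hle]; simp)
      refine ⟨c, by omega, by omega, fun n hn r hr h => ?_⟩
      have hlog : Nat.log 2 m = n :=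
        Nat.log_eq_of_pow_le_of_lt_pow (by omega) (by rw [pow_succ]; omega)
      rw [hlog, show m - 2 ^ n = r by omega] at hc
      rw [← hc]
      ring
  choose b hb using h
  exact ⟨b, ((hb 0).1 rfl).symm, ((hb 1).2.1 rfl).symm,
    fun n hn r hr => (hb (2 ^ n + r)).2.2 n hn r hr rfl⟩

theorem IsCoeff.displacement_dvd
    (hf : ∀ k a c, (2 : ℤ_[2]) ^ k ∣ a - c → (2 : ℤ_[2]) ^ k ∣ f a - f c) (hb : IsCoeff f b)
    (h01 : (2 : ℤ_[2]) ∣ b 1 - b 0 - 1) (hodd : ∀ m, 2 ≤ m → (2 : ℤ_[2]) ∣ b m - 1)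
    (k : ℕ) (a c : ℤ_[2]) (hac : (2 : ℤ_[2]) ^ k ∣ a - c) :
    (2 : ℤ_[2]) ^ (k + 1) ∣ (f a - a) - (f c - c) := by
  have key : ∀ r s : ℕ, r < 2 ^ k → s < 2 ^ (k + 1) → (2 : ℤ_[2]) ^ k ∣ (s : ℤ_[2]) - r →
      (2 : ℤ_[2]) ^ (k + 1) ∣ (f s - s) - (f r - r) := by
    intro r s hr hs hsr
    rcases lt_or_ge s (2 ^ k) with h | h
    · rw [eq_of_two_pow_dvd_natCast_sub h hr hsr, sub_self]
      exact dvd_zero _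
    · obtain ⟨t, rfl⟩ := Nat.exists_eq_add_of_le h
      have ht : t < 2 ^ k := by rw [pow_succ] at hs; omega
      have htr : t = r := by
        refine eq_of_two_pow_dvd_natCast_sub ht hr ?_
        have := dvd_sub hsr (dvd_refl (2 ^ k))
        convert this using 1
        push_cast
        ring
      subst htr
      rcases Nat.eq_zero_or_pos k with rfl | hk
      · obtain rfl : t = 0 := by omega
        simpa [hb.zero, hb.one, sub_right_comm] using h01
      · have h2 : 2 ≤ 2 ^ k := by simpa using Nat.pow_le_pow_right (n := 2) (by norm_num) hk
        rw [hb.add_eq k hk t ht, pow_succ]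
        have := mul_dvd_mul_left (2 ^ k) (hodd (2 ^ k + t) (by omega))
        convert this using 1
        push_cast
        ring
  have key' : ∀ (r : ℕ) (x : ℤ_[2]), r < 2 ^ k → (2 : ℤ_[2]) ^ k ∣ x - r →
      (2 : ℤ_[2]) ^ (k + 1) ∣ (f x - x) - (f r - r) := by
    intro r x hr hxr
    obtain ⟨s, hs, hxs⟩ := exists_nat_two_pow_dvd_sub (k + 1) x
    have h1 := (pow_dvd_pow (2 : ℤ_[2]) (Nat.le_succ k)).trans hxs
    have h2 := key r s hr hs (by simpa using dvd_sub hxr h1)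
    have h3 := dvd_add (dvd_sub (hf _ _ _ hxs) hxs) h2
    convert h3 using 1
    ring
  obtain ⟨r, hr, har⟩ := exists_nat_two_pow_dvd_sub k a
  have hcr : (2 : ℤ_[2]) ^ k ∣ c - r := by simpa using dvd_sub har hac
  simpa using dvd_sub (key' r a hr har) (key' r c hr hcr)

theorem IsCoeff.sum_displacement_succ (hb : IsCoeff f b) {k : ℕ} (hk : 1 ≤ k) :
    ∑ x ∈ range (2 ^ (k + 1)), (f x - x) = 2 * ∑ x ∈ range (2 ^ k), (f x - x) +
      2 ^ k * (∑ m ∈ Ico (2 ^ k) (2 ^ (k + 1)), b m - 2 ^ k) := by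
  have h2 : 2 ^ (k + 1) - 2 ^ k = 2 ^ k := by rw [pow_succ]; omega
  have h3 : ∀ x ∈ range (2 ^ k), f ((2 ^ k + x : ℕ) : ℤ_[2]) - ((2 ^ k + x : ℕ) : ℤ_[2]) =
      (f x - x) + (2 ^ k * b (2 ^ k + x) - 2 ^ k) := by
    intro x hx
    rw [hb.add_eq k hk x (mem_range.1 hx)]
    push_cast
    ring
  rw [sum_Ico_eq_sum_range, h2, pow_succ, mul_two, sum_range_add, sum_congr rfl h3,
    sum_add_distrib, sum_sub_distrib (fun x => 2 ^ k * b (2 ^ k + x)), ← mul_sum, sum_const,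
    card_range, nsmul_eq_mul]
  push_cast
  ring

theorem IsCoeff.sum_displacement_dvd_succ_iff (hb : IsCoeff f b) {k : ℕ} (hk : 1 ≤ k)
    (h : (2 : ℤ_[2]) ^ (k + 1) ∣ ∑ x ∈ range (2 ^ k), (f x - x) - 2 ^ k) :
    (2 : ℤ_[2]) ^ (k + 2) ∣ ∑ x ∈ range (2 ^ (k + 1)), (f x - x) - 2 ^ (k + 1) ↔
      (4 : ℤ_[2]) ∣ ∑ m ∈ Ico (2 ^ k) (2 ^ (k + 1)), b m - 2 ^ k := by
  have h1 := mul_dvd_mul_left 2 h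
  rw [← pow_succ'] at h1
  rw [hb.sum_displacement_succ hk, show ∀ S T : ℤ_[2], 2 * S + T - 2 ^ (k + 1) =
    2 * (S - 2 ^ k) + T from fun S T => by ring, dvd_add_right h1, add_assoc, pow_add,
    mul_dvd_mul_iff_left (pow_ne_zero k two_ne_zero)]
  norm_num

theorem IsCoeff.transitive_iff
    (hf : ∀ k a c, (2 : ℤ_[2]) ^ k ∣ a - c → (2 : ℤ_[2]) ^ k ∣ f a - f c) (hb : IsCoeff f b) :
    (∀ k, 1 ≤ k → TransitiveMod f k) ↔
      (2 : ℤ_[2]) ∣ (b 0 - 1) ∧ (4 : ℤ_[2]) ∣ (b 0 + b 1 - 3) ∧ (∀ m : ℕ, 2 ≤ m → ‖b m‖ = 1) ∧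
        (4 : ℤ_[2]) ∣ (b 2 + b 3 - 2) ∧
        (∀ n : ℕ, 3 ≤ n → (4 : ℤ_[2]) ∣ ∑ m ∈ Ico (2 ^ (n - 1)) (2 ^ n), b m) := by
  have hz : (2 : ℤ_[2]) ^ (0 + 1) ∣ ∑ x ∈ range (2 ^ 0), (f x - x) - 2 ^ 0 ↔
      (2 : ℤ_[2]) ∣ b 0 - 1 := by simp [hb.zero]
  have ho : (2 : ℤ_[2]) ^ (1 + 1) ∣ ∑ x ∈ range (2 ^ 1), (f x - x) - 2 ^ 1 ↔
      (4 : ℤ_[2]) ∣ b 0 + b 1 - 3 := by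
    simp only [pow_one, sum_range_succ, range_zero, sum_empty, Nat.cast_zero, Nat.cast_one,
      hb.zero, hb.one]
    norm_num
    ring_nf
  have ht : (4 : ℤ_[2]) ∣ ∑ m ∈ Ico (2 ^ 1) (2 ^ (1 + 1)), b m - 2 ^ 1 ↔
      (4 : ℤ_[2]) ∣ b 2 + b 3 - 2 := by
    norm_num [sum_Ico_eq_sum_range, sum_range_succ]
  have hs : ∀ k, 2 ≤ k → ((4 : ℤ_[2]) ∣ ∑ m ∈ Ico (2 ^ k) (2 ^ (k + 1)), b m - 2 ^ k ↔
      (4 : ℤ_[2]) ∣ ∑ m ∈ Ico (2 ^ k) (2 ^ (k + 1)), b m) := by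
    intro k hk
    refine dvd_sub_left ?_
    have := pow_dvd_pow (2 : ℤ_[2]) hk
    norm_num at this
    exact this
  simp only [norm_eq_one_iff_two_dvd_sub_one]
  constructor
  · intro h
    have hT : ∀ k, TransitiveMod f k := fun k => by
      rcases Nat.eq_zero_or_pos k with rfl | hk
      · exact transitiveMod_zero hf
      · exact h k hk
    have hd := displacement_dvd_of_injective hf fun k => inducedMod_injective hf (hT k) (hT (k + 1))
    have hD := fun k => (transitiveMod_succ_iff hf hd (hT k)).1 (hT (k + 1))
    have hC := fun k (hk : 1 ≤ k) =>
      (hb.sum_displacement_dvd_succ_iff hk (hD k)).1 (hD (k + 1))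
    refine ⟨hz.1 (hD 0), ho.1 (hD 1), fun m hm => ?_, ht.1 (hC 1 le_rfl), fun n hn => ?_⟩
    · have hn : 1 ≤ Nat.log 2 m := Nat.le_log_of_pow_le (by norm_num) (by omega)
      have hle := Nat.pow_log_le_self 2 (show m ≠ 0 by omega)
      have hlt := Nat.lt_pow_succ_log_self (b := 2) (by norm_num) m
      generalize Nat.log 2 m = n at *
      obtain ⟨r, rfl⟩ := Nat.exists_eq_add_of_le hle
      have h1 := hd n ((2 ^ n + r : ℕ) : ℤ_[2]) r (by simp)
      rw [hb.add_eq n hn r (by rw [pow_succ] at hlt; omega), pow_succ] at h1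
      refine (mul_dvd_mul_iff_left (pow_ne_zero n (two_ne_zero (α := ℤ_[2])))).1 ?_
      convert h1 using 1
      push_cast
      ring
    · obtain ⟨k, rfl⟩ := Nat.exists_eq_add_of_le' (show 1 ≤ n by omega)
      exact (hs k (by omega)).1 (hC k (by omega))
  · rintro ⟨h0, h1, hodd, h23, hsum⟩
    have h01 : (2 : ℤ_[2]) ∣ b 1 - b 0 - 1 := by
      have h4 : (2 : ℤ_[2]) ∣ b 0 + b 1 - 3 := (Dvd.intro 2 (by norm_num)).trans h1
      have := dvd_sub h4 (Dvd.intro (b 0 - 1) rfl : (2 : ℤ_[2]) ∣ 2 * (b 0 - 1))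
      convert this using 1
      ring
    have hd := hb.displacement_dvd hf h01 hodd
    have hC : ∀ k, 1 ≤ k → (4 : ℤ_[2]) ∣ ∑ m ∈ Ico (2 ^ k) (2 ^ (k + 1)), b m - 2 ^ k := by
      intro k hk
      rcases hk.eq_or_lt with rfl | hk
      · exact ht.2 h23
      · exact (hs k hk).2 (hsum (k + 1) (by omega))
    have hD1 : ∀ k, 1 ≤ k → (2 : ℤ_[2]) ^ (k + 1) ∣ ∑ x ∈ range (2 ^ k), (f x - x) - 2 ^ k := by
      intro k hk
      induction k, hk using Nat.le_induction with
      | base => exact ho.2 h1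
      | succ k hk ih => exact (hb.sum_displacement_dvd_succ_iff hk ih).2 (hC k hk)
    have hT : ∀ k, TransitiveMod f k := by
      intro k
      induction k with
      | zero => exact transitiveMod_zero hf
      | succ k ih =>
        refine (transitiveMod_succ_iff hf hd ih).2 ?_
        rcases Nat.eq_zero_or_pos k with rfl | hk
        · exact hz.2 h0
        · exact hD1 k hk
    exact fun k _ => hT k

end Coefficients

end VanDerPut

/-- A map `f : ℤ_2 → ℤ_2` is an ergodic T-function (a 1-Lipschitz function that is transitive
modulo `2^k` for every `k ≥ 1`) if and only if it can be represented as
`f x = b_0·χ(0,x) + b_1·χ(1,x) + Σ_{m≥2} 2^{⌊log_2 m⌋}·b_m·χ(m,x)` with `b_m ∈ ℤ_2`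
satisfying (1) `b_0 ≡ 1 (mod 2)`; (2) `b_0 + b_1 ≡ 3 (mod 4)`; (3) `‖b_m‖ = 1` for `m ≥ 2`;
(4) `b_2 + b_3 ≡ 2 (mod 4)`; (5) `Σ_{m=2^{n−1}}^{2^n−1} b_m ≡ 0 (mod 4)` for every `n ≥ 3`. -/
theorem ergodic_iff_vdp_form
    (f : ℤ_[2] → ℤ_[2]) :
    ((∀ a b : ℤ_[2], ‖f a - f b‖ ≤ ‖a - b‖) ∧
        ∀ k : ℕ, 1 ≤ k → TransitiveMod f k) ↔
      ∃ b : ℕ → ℤ_[2],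
        (∀ x : ℤ_[2], f x = b 0 * vdpChi 0 x + b 1 * vdpChi 1 x +
            ∑' m : ℕ, 2 ^ (Nat.log 2 (m + 2)) * b (m + 2) * vdpChi (m + 2) x) ∧
        (2 : ℤ_[2]) ∣ (b 0 - 1) ∧
        (4 : ℤ_[2]) ∣ (b 0 + b 1 - 3) ∧
        (∀ m : ℕ, 2 ≤ m → ‖b m‖ = 1) ∧
        (4 : ℤ_[2]) ∣ (b 2 + b 3 - 2) ∧
        (∀ n : ℕ, 3 ≤ n → (4 : ℤ_[2]) ∣ ∑ m ∈ Finset.Ico (2 ^ (n - 1)) (2 ^ n), b m) := by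
  rw [VanDerPut.lipschitz_iff_two_pow_dvd]
  constructor
  · rintro ⟨hf, hT⟩
    obtain ⟨b, hb⟩ := VanDerPut.exists_isCoeff hf
    exact ⟨b, VanDerPut.lipschitz_and_isCoeff_iff.1 ⟨hf, hb⟩, (hb.transitive_iff hf).1 hT⟩
  · rintro ⟨b, hrep, hcond⟩
    obtain ⟨hf, hb⟩ := VanDerPut.lipschitz_and_isCoeff_iff.2 hrep
    exact ⟨hf, (hb.transitive_iff hf).2 hcond⟩
end
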